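/- Let m>1 and 0<p<1 be reals with m+p<2, let N≥1 be an integer, and let σ=2(1−p)/(m−1). Then for every α>0 there is no good profile with interface. -/

import Mathlib

open Real Set Filter Topology

noncomputable section

/-- The self-similar profile ODE
`(f^m)'' + ((N-1)/ξ)(f^m)' - α f + β ξ f' + ξ^σ f^p = 0` at the point `ξ`. -/
def ProfileODE (m p σ α β : ℝ) (N : ℕ) (f : ℝ → ℝ) (ξ : ℝ) : Prop :=
  deriv (deriv (fun x => f x ^ m)) ξ + ((N : ℝ) - 1) / ξ * deriv (fun x => f x ^ m) ξ
    - α * f ξ + β * ξ * deriv f ξ + ξ ^ σ * f ξ ^ p = 0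

/-- A good profile with interface for the parameter `α` (with `β = (m-1)α/2`),
vanishing at `ξ₀`. -/
structure GoodProfile (m p σ α β : ℝ) (N : ℕ) (f : ℝ → ℝ) (ξ₀ : ℝ) : Prop where
  cont : ContinuousOn f (Ici 0)
  nonneg : ∀ ξ ∈ Ici (0 : ℝ), 0 ≤ f ξ
  init : f 0 = 1
  deriv_zero : HasDerivWithinAt f 0 (Ici 0) 0
  xi0_pos : 0 < ξ₀
  vanish : f ξ₀ = 0
  pos : ∀ ξ ∈ Ioo 0 ξ₀, 0 < f ξ
  smooth : ContDiffOn ℝ 2 f (Ioo 0 ξ₀)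
  ode : ∀ ξ ∈ Ioo 0 ξ₀, ProfileODE m p σ α β N f ξ
  interface : Tendsto (fun ξ => deriv (fun x => f x ^ m) ξ) (𝓝[<] ξ₀) (𝓝 0)


/-- A function with nonpositive derivative on `(a, b)` and left limit `0` at `b` is nonnegative. -/
lemma nonneg_of_hasDerivAt_nonpos_of_tendsto_zero {a b : ℝ} {g g' : ℝ → ℝ}
    (hg : ∀ x ∈ Ioo a b, HasDerivAt g (g' x) x) (hg' : ∀ x ∈ Ioo a b, g' x ≤ 0)
    (hlim : Tendsto g (𝓝[<] b) (𝓝 0)) : ∀ x ∈ Ioo a b, 0 ≤ g x := by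
  intro x hx
  have hanti : AntitoneOn g (Ioo a b) := by
    apply antitoneOn_of_deriv_nonpos (convex_Ioo a b)
    · exact fun y hy => (hg y hy).continuousAt.continuousWithinAt
    · rw [interior_Ioo]
      exact fun y hy => (hg y hy).differentiableAt.differentiableWithinAt
    · rw [interior_Ioo]
      intro y hy
      rw [(hg y hy).deriv]
      exact hg' y hy
  refine le_of_tendsto hlim ?_
  filter_upwards [Ioo_mem_nhdsLT hx.2] with y hy
  exact hanti hx ⟨hx.1.trans hy.1, hy.2⟩ hy.1.le

/-- Local obstruction at an interface: near `b`, the ODE forces the flux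
`(f^m)' + c / x * f^m + β x f` to dominate `f ^ (m + p - 1)`, which is incompatible with
`f → 0` when `m + p < 2`. -/
lemma false_of_interface {m p σ α β c b : ℝ} {f : ℝ → ℝ}
    (hm : 1 < m) (hp0 : 0 < p) (hp1 : p < 1) (hmp : m + p < 2) (hσ : 0 < σ)
    (hα : 0 < α) (hβ : 0 < β) (hc : 0 ≤ c) (hb : 0 < b)
    (hcont : ContinuousOn f (Icc 0 b)) (hfb : f b = 0)
    (hpos : ∀ x ∈ Ioo 0 b, 0 < f x) (hf : ContDiffOn ℝ 2 f (Ioo 0 b))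
    (hode : ∀ x ∈ Ioo 0 b, deriv (deriv (fun x => f x ^ m)) x
      + c / x * deriv (fun x => f x ^ m) x - α * f x + β * x * deriv f x
      + x ^ σ * f x ^ p = 0)
    (hflux : Tendsto (fun x => deriv (fun x => f x ^ m) x) (𝓝[<] b) (𝓝 0)) : False := by
  set W : ℝ → ℝ := fun x => f x ^ m with hW
  have hm0 : 0 < m := by linarith
  have hq : 0 < m + p - 1 := by linarith
  have hdf : ∀ x ∈ Ioo 0 b, HasDerivAt f (deriv f x) x := fun x hx =>
    ((hf.differentiableOn (by norm_num)).differentiableAt (isOpen_Ioo.mem_nhds hx)).hasDerivAt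
  have hWsmooth : ContDiffOn ℝ 2 W (Ioo 0 b) :=
    hf.rpow_const_of_ne fun x hx => (hpos x hx).ne'
  have hdW : ∀ x ∈ Ioo 0 b, HasDerivAt W (deriv W x) x := fun x hx =>
    ((hWsmooth.differentiableOn (by norm_num)).differentiableAt
      (isOpen_Ioo.mem_nhds hx)).hasDerivAt
  have hddW : ∀ x ∈ Ioo 0 b, HasDerivAt (deriv W) (deriv (deriv W) x) x := fun x hx =>
    (((hWsmooth.deriv_of_isOpen (m := 1) isOpen_Ioo (by norm_num)).differentiableOn
      (by norm_num)).differentiableAt (isOpen_Ioo.mem_nhds hx)).hasDerivAt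
  have hWeq : ∀ x ∈ Ioo 0 b, deriv W x = deriv f x * m * f x ^ (m - 1) := fun x hx =>
    ((hdf x hx).rpow_const (Or.inl (hpos x hx).ne')).deriv
  have hflim : Tendsto f (𝓝[<] b) (𝓝 0) := by
    have h := (hcont b ⟨hb.le, le_rfl⟩).mono_left
      (nhdsWithin_mono b (Ioo_subset_Icc_self : Ioo 0 b ⊆ Icc 0 b))
    rwa [nhdsWithin_Ioo_eq_nhdsLT hb, hfb] at h
  have hpow : ∀ e : ℝ, 0 < e → Tendsto (fun x => f x ^ e) (𝓝[<] b) (𝓝 0) := fun e he => by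
    simpa [Real.zero_rpow he.ne'] using hflim.rpow_const (p := e) (Or.inr he.le)
  have hid : Tendsto (fun x : ℝ => x) (𝓝[<] b) (𝓝 b) := tendsto_nhdsWithin_of_tendsto_nhds tendsto_id
  set c₀ : ℝ := (b / 2) ^ σ with hc₀
  have hc₀pos : 0 < c₀ := by positivity
  set C : ℝ := 2 * c / b + β * b with hC
  have hCpos : 0 < C := by positivity
  set k : ℝ := c₀ * m / (2 * (m + p - 1) * C) with hk
  have hkpos : 0 < k := by positivity
  obtain ⟨a, hab, ha⟩ : ∃ a ∈ Iio b, ∀ x ∈ Ioo a b, b / 2 < x ∧ f x < 1 ∧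
      f x ^ (1 - p) < c₀ / (2 * (α + β)) ∧ f x ^ (2 - m - p) < k / C := by
    have h : ∀ᶠ x in 𝓝[<] b, b / 2 < x ∧ f x < 1 ∧
        f x ^ (1 - p) < c₀ / (2 * (α + β)) ∧ f x ^ (2 - m - p) < k / C :=
      (hid.eventually_const_lt (by linarith)).and <|
        (hflim.eventually_lt_const one_pos).and <|
        ((hpow (1 - p) (by linarith)).eventually_lt_const (by positivity)).and
        ((hpow (2 - m - p) (by linarith)).eventually_lt_const (by positivity))
    exact (mem_nhdsLT_iff_exists_Ioo_subset).1 h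
  have hab : a < b := hab
  set a' := max a (b / 2) with ha'
  have ha'b : a' < b := max_lt hab (by linarith)
  have hsub : ∀ x ∈ Ioo a' b, x ∈ Ioo 0 b := fun x hx =>
    ⟨lt_trans (by linarith [le_max_right a (b / 2)] : 0 < a') hx.1, hx.2⟩
  replace ha : ∀ x ∈ Ioo a' b, b / 2 < x ∧ f x < 1 ∧
      f x ^ (1 - p) < c₀ / (2 * (α + β)) ∧ f x ^ (2 - m - p) < k / C := fun x hx =>
    ha x ⟨(le_max_left _ _).trans_lt hx.1, hx.2⟩
  set V : ℝ → ℝ := fun x => deriv W x + c / x * W x + β * x * f x with hV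
  set V' : ℝ → ℝ := fun x => -(c / x ^ 2) * W x + (α + β) * f x - x ^ σ * f x ^ p with hV'
  have hVd : ∀ x ∈ Ioo a' b, HasDerivAt V (V' x) x := by
    intro x hx
    have hx0 := hsub x hx
    have h1 : HasDerivAt (fun y : ℝ => c / y) (-(c / x ^ 2)) x := by
      simp only [div_eq_mul_inv]
      exact ((hasDerivAt_inv hx0.1.ne').const_mul c).congr_deriv (by ring)
    refine (((hddW x hx0).add (h1.mul (hdW x hx0))).add
      (((hasDerivAt_id x).const_mul β).mul (hdf x hx0))).congr_deriv ?_
    have := hode x hx0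
    simp only [hV', id]
    linarith
  have hV'le : ∀ x ∈ Ioo a' b, V' x ≤ -(c₀ / 2) * f x ^ p := by
    intro x hx
    obtain ⟨h1, -, h3, -⟩ := ha x hx
    have hx0 := hsub x hx
    have hfx := hpos x hx0
    have hfp : 0 < f x ^ p := by positivity
    have hWx : 0 ≤ c / x ^ 2 * W x := by simp only [hW]; positivity
    have h5 : c₀ ≤ x ^ σ := Real.rpow_le_rpow (by positivity) h1.le hσ.le
    have h6 : f x = f x ^ (1 - p) * f x ^ p := by
      rw [← Real.rpow_add hfx]; simp
    have h7 : (α + β) * f x ^ (1 - p) ≤ c₀ / 2 := by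
      rw [lt_div_iff₀ (by positivity)] at h3
      linarith
    have h8 : (α + β) * f x ≤ c₀ / 2 * f x ^ p := by
      calc (α + β) * f x = (α + β) * f x ^ (1 - p) * f x ^ p := by rw [mul_assoc, ← h6]
        _ ≤ _ := by gcongr
    have h9 : c₀ * f x ^ p ≤ x ^ σ * f x ^ p := by gcongr
    simp only [hV']
    linarith
  have hlow : ∀ x ∈ Ioo a' b, c / x * W x + β * x * f x ≤ C * f x := by
    intro x hx
    obtain ⟨h1, h2, -, -⟩ := ha x hx
    have hx0 := hsub x hx
    have hfx := hpos x hx0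
    have h3 : W x ≤ f x := by
      simpa [hW] using Real.rpow_le_rpow_of_exponent_ge hfx h2.le hm.le
    have h4 : c / x ≤ 2 * c / b := by
      rw [div_le_div_iff₀ hx0.1 hb]
      nlinarith
    have h5 : c / x * W x ≤ 2 * c / b * f x := by
      have : 0 ≤ W x := by simp only [hW]; positivity
      gcongr
    have h6 : β * x * f x ≤ β * b * f x := by
      have := hx0.2.le
      gcongr
    rw [hC, add_mul]
    linarith
  have hWlim := hpow m hm0
  have hVlim : Tendsto V (𝓝[<] b) (𝓝 0) := by
    have h := (hflux.add (((tendsto_const_nhds (x := c)).div hid hb.ne').mul hWlim)).add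
      (((tendsto_const_nhds (x := β)).mul hid).mul hflim)
    simpa using h
  have hV0 := nonneg_of_hasDerivAt_nonpos_of_tendsto_zero hVd
    (fun x hx => (hV'le x hx).trans (by
      have := hpos x (hsub x hx)
      rw [neg_mul, neg_nonpos]
      positivity)) hVlim
  have hUd : ∀ x ∈ Ioo a' b, HasDerivAt (fun y => V y - k * f y ^ (m + p - 1))
      (V' x - k * (deriv f x * (m + p - 1) * f x ^ (m + p - 1 - 1))) x := fun x hx =>
    (hVd x hx).sub (((hdf x (hsub x hx)).rpow_const
      (Or.inl (hpos x (hsub x hx)).ne')).const_mul k)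
  have hU0 := nonneg_of_hasDerivAt_nonpos_of_tendsto_zero hUd (by
    intro x hx
    have hx0 := hsub x hx
    have hfx := hpos x hx0
    have h1 : -(deriv W x) ≤ C * f x := by
      have := hV0 x hx
      simp only [hV] at this
      linarith [hlow x hx]
    have h2 : -(k * (deriv f x * (m + p - 1) * f x ^ (m + p - 1 - 1)))
        = k * (m + p - 1) / m * (-(deriv W x)) * f x ^ (p - 1) := by
      rw [hWeq x hx0, show m + p - 1 - 1 = (m - 1) + (p - 1) by ring, Real.rpow_add hfx]
      field_simp
    have h3 : k * (m + p - 1) / m * C = c₀ / 2 := by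
      rw [hk]
      field_simp
    have h4 : f x * f x ^ (p - 1) = f x ^ p := by
      rw [mul_comm, Real.rpow_sub_one hfx.ne']
      field_simp
    have h5 : k * (m + p - 1) / m * (-(deriv W x)) * f x ^ (p - 1)
        ≤ k * (m + p - 1) / m * (C * f x) * f x ^ (p - 1) := by gcongr
    have h6 : k * (m + p - 1) / m * (C * f x) * f x ^ (p - 1) = c₀ / 2 * f x ^ p := by
      rw [← h3, ← h4]
      ring
    linarith [hV'le x hx]) (by simpa using hVlim.sub ((hpow _ hq).const_mul k))
  set x₀ := (a' + b) / 2 with hx₀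
  have hx₀mem : x₀ ∈ Ioo a' b := ⟨by linarith, by linarith⟩
  obtain ⟨x, hx, hslope⟩ := exists_deriv_eq_slope f hx₀mem.2
    (hcont.mono (Icc_subset_Icc_left (hsub _ hx₀mem).1.le))
    (fun y hy => (hdf y ⟨(hsub _ hx₀mem).1.trans hy.1,
      hy.2⟩).differentiableAt.differentiableWithinAt)
  have hxmem : x ∈ Ioo a' b := ⟨hx₀mem.1.trans hx.1, hx.2⟩
  have hx0 := hsub x hxmem
  have hfx := hpos x hx0
  have hneg : deriv f x ≤ 0 := by
    rw [hslope, hfb]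
    exact div_nonpos_of_nonpos_of_nonneg (by linarith [hpos _ (hsub _ hx₀mem)])
      (by linarith [hx₀mem.2])
  have hWneg : deriv W x ≤ 0 := by
    rw [hWeq x hx0, mul_assoc]
    exact mul_nonpos_of_nonpos_of_nonneg hneg (by positivity)
  have hU := hU0 x hxmem
  simp only [hV] at hU
  have hle : k * f x ^ (m + p - 1) ≤ C * f x := by linarith [hlow x hxmem]
  have hlt := (ha x hxmem).2.2.2
  rw [lt_div_iff₀ hCpos] at hlt
  have hsplit : f x = f x ^ (2 - m - p) * f x ^ (m + p - 1) := by
    rw [← Real.rpow_add hfx]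
    ring_nf
    simp
  have hq' : 0 < f x ^ (m + p - 1) := by positivity
  have : C * f x < k * f x ^ (m + p - 1) := by
    calc C * f x = f x ^ (2 - m - p) * C * f x ^ (m + p - 1) := by
          rw [mul_comm _ C, mul_assoc, ← hsplit]
      _ < _ := by gcongr
  linarith

/-- Theorem 1.3 of the paper: non-existence of good profiles with interface
when `m + p < 2`, `σ = 2(1-p)/(m-1)`. -/
theorem no_eternal_profiles_mp_lt_two (m p : ℝ) (N : ℕ)
    (hm : 1 < m) (hp0 : 0 < p) (hp1 : p < 1) (hmp : m + p < 2) (hN : 1 ≤ N) :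
    ∀ α : ℝ, 0 < α →
      ¬ ∃ (f : ℝ → ℝ) (ξ₀ : ℝ),
          GoodProfile m p (2 * (1 - p) / (m - 1)) α ((m - 1) * α / 2) N f ξ₀ := by
  rintro α hα ⟨f, ξ₀, h⟩
  have hm' : 0 < m - 1 := by linarith
  have hp' : 0 < 1 - p := by linarith
  have hN' : (1 : ℝ) ≤ N := by exact_mod_cast hN
  exact false_of_interface hm hp0 hp1 hmp (by positivity) hα (by positivity)
    (sub_nonneg.2 hN') h.xi0_pos (h.cont.mono Icc_subset_Ici_self) h.vanish h.pos h.smooth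
    h.ode h.interface
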